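/- Let q = p^e be a prime power, let r ≥ 1 be an integer, and let d ≥ 1 be an integer such that ∑_{a ∈ A_{<d}} a^j = 0 for every integer j with 1 ≤ j ≤ r. Let a, b ∈ A = 𝔽_q[T] with T^d ∣ a and T^d ∣ b. Then for every integer i with 1 ≤ i ≤ r, one has ∑_{(u,v) ∈ A_{<d}² \ {(0,0)}} (b u − a v)^i (a + u)^{r−i} = 0 in A. -/

import Mathlib

open Polynomial

namespace Polynomial

variable {F : Type*} [Field F] [Fintype F]

theorem finite_setOf_degree_lt (d : ℕ) :
    {a : F[X] | a.degree < (d : WithBot ℕ)}.Finite := by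
  have : Finite (degreeLT F d) := Finite.of_equiv _ (degreeLTEquiv F d).symm.toEquiv
  refine (Set.toFinite (degreeLT F d : Set F[X])).subset fun a ha => ?_
  exact mem_degreeLT.mpr ha

theorem cast_card_degree_lt_eq_zero {d : ℕ} (hd : 1 ≤ d) :
    (((finite_setOf_degree_lt (F := F) d).toFinset.card : ℕ) : F[X]) = 0 := by
  have hcard : (finite_setOf_degree_lt (F := F) d).toFinset.card = Fintype.card F ^ d := by
    rw [← Set.ncard_eq_toFinset_card _ (finite_setOf_degree_lt d), ← Nat.card_coe_set_eq]
    have e : {a : F[X] | a.degree < (d : WithBot ℕ)} ≃ (Fin d → F) :=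
      (Equiv.subtypeEquivRight fun a => mem_degreeLT.symm).trans (degreeLTEquiv F d).toEquiv
    rw [Nat.card_congr e]
    simp
  rw [hcard, ← C_eq_natCast, Nat.cast_pow, FiniteField.cast_card_eq_zero,
    zero_pow (by omega), C_0]

/-- If the power sums of exponents `1, …, r` over the polynomials of degree less than `d` vanish,
then so do the sums of `i`-th powers of any affine function, for `i ≤ r`. -/
theorem sum_affine_pow_degree_lt_eq_zero {r d : ℕ} (hd : 1 ≤ d)
    (hsum : ∀ j : ℕ, 1 ≤ j → j ≤ r →
      (∑ᶠ a ∈ {a : F[X] | a.degree < (d : WithBot ℕ)}, a ^ j) = 0)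
    (x c : F[X]) {i : ℕ} (hi : i ≤ r) :
    ∑ v ∈ (finite_setOf_degree_lt (F := F) d).toFinset, (c * v + x) ^ i = 0 := by
  simp_rw [add_pow, mul_pow]
  rw [Finset.sum_comm]
  refine Finset.sum_eq_zero fun k hk => ?_
  have hpow : ∑ v ∈ (finite_setOf_degree_lt (F := F) d).toFinset, v ^ k = 0 := by
    rcases Nat.eq_zero_or_pos k with rfl | hk0
    · simpa using cast_card_degree_lt_eq_zero (F := F) hd
    · rw [← finsum_mem_eq_finite_toFinset_sum]
      exact hsum k hk0 (by have := Finset.mem_range.mp hk; omega)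
  simp_rw [← Finset.sum_mul, ← Finset.mul_sum, hpow, mul_zero, zero_mul]

end Polynomial

/-- Let `q = p^e` be a prime power, `r ≥ 1`, and `d ≥ 1` such that
`∑_{a ∈ A_{<d}} a^j = 0` for all `1 ≤ j ≤ r`. Let `a, b ∈ A = 𝔽_q[T]` with `T^d ∣ a` and
`T^d ∣ b`. Then for every `1 ≤ i ≤ r` one has
`∑_{(u,v) ∈ A_{<d}² \ {(0,0)}} (bu - av)^i (a + u)^{r-i} = 0` in `A`. -/
theorem power_sum_pairs_vanishing (p e : ℕ) (hp : p.Prime) (he : 0 < e)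
    (F : Type*) [Field F] [Fintype F] (hcard : Fintype.card F = p ^ e)
    (r : ℕ) (hr : 1 ≤ r) (d : ℕ) (hd : 1 ≤ d)
    (hsum : ∀ j : ℕ, 1 ≤ j → j ≤ r →
      (∑ᶠ a ∈ {a : Polynomial F | a.degree < (d : WithBot ℕ)}, a ^ j) = 0)
    (a b : Polynomial F) (ha : X ^ d ∣ a) (hb : X ^ d ∣ b)
    (i : ℕ) (hi1 : 1 ≤ i) (hi2 : i ≤ r) :
    (∑ᶠ uv ∈ {uv : Polynomial F × Polynomial F |
        uv.1.degree < (d : WithBot ℕ) ∧ uv.2.degree < (d : WithBot ℕ) ∧ uv ≠ 0},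
      (b * uv.1 - a * uv.2) ^ i * (a + uv.1) ^ (r - i)) = 0 := by
  have hS := finite_setOf_degree_lt (F := F) d
  have hsub : (∑ᶠ uv ∈ {uv : Polynomial F × Polynomial F |
        uv.1.degree < (d : WithBot ℕ) ∧ uv.2.degree < (d : WithBot ℕ) ∧ uv ≠ 0},
      (b * uv.1 - a * uv.2) ^ i * (a + uv.1) ^ (r - i)) =
      ∑ uv ∈ hS.toFinset ×ˢ hS.toFinset,
        (b * uv.1 - a * uv.2) ^ i * (a + uv.1) ^ (r - i) := by
    refine finsum_mem_eq_sum_of_inter_support_eq _ (Set.ext fun uv => ?_)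
    simp only [Set.mem_inter_iff, Set.mem_ofPred_eq, Function.mem_support, Finset.coe_product,
      Set.Finite.coe_toFinset, Set.mem_prod]
    refine ⟨fun h => ⟨⟨h.1.1, h.1.2.1⟩, h.2⟩, fun h => ⟨⟨h.1.1, h.1.2, ?_⟩, h.2⟩⟩
    rintro rfl
    exact h.2 (by simp [show i ≠ 0 by omega])
  rw [hsub, Finset.sum_product]
  refine Finset.sum_eq_zero fun u _ => ?_
  dsimp only
  rw [← Finset.sum_mul]
  have h := sum_affine_pow_degree_lt_eq_zero hd hsum (b * u) (-a) hi2
  simp_rw [neg_mul, neg_add_eq_sub] at h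
  rw [h, zero_mul]
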